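/- Let G be an integral domain containing a field k, and let P be a prime ideal of G. Assume that both trdeg_k G and trdeg_k (G/P) are finite. Then the height of P is less than or equal to trdeg_k G − trdeg_k (G/P). -/

import Mathlib

open scoped Classical
noncomputable section

/-- The transcendence degree over `k` of a commutative `k`-algebra `A` (for an integral
domain this agrees with the transcendence degree of the fraction field of `A` over `k`):
the supremum of the cardinalities of the algebraically independent subsets of `A`. -/
def trdeg (k A : Type) [CommRing k] [CommRing A] [Algebra k A] : Cardinal :=
  ⨆ s : { s : Set A // AlgebraicIndependent k ((↑) : s → A) }, Cardinal.mk s.1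

/-- A non-injective surjection from a domain onto a domain lowers the transcendence degree. -/
theorem Algebra.trdeg_add_one_le_of_surjective_of_map_eq_zero.{u} {R : Type*}
    {A B : Type u} [CommRing R] [Nontrivial R] [CommRing A] [IsDomain A] [CommRing B] [IsDomain B]
    [Algebra R A] [Algebra R B] [FaithfulSMul R B] (f : A →ₐ[R] B) (hf : Function.Surjective f) {a : A}
    (ha : a ≠ 0) (hfa : f a = 0) :
    Algebra.trdeg R B + 1 ≤ Algebra.trdeg R A := by
  obtain ⟨s, hs⟩ := exists_isTranscendenceBasis R B
  set x : s → A := fun i ↦ Function.surjInv hf i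
  have hfx : f ∘ x = ((↑) : s → B) := funext fun i ↦ Function.surjInv_eq hf i
  have hx : AlgebraicIndependent R x := .of_comp f (hfx ▸ hs.1)
  have htrans : Transcendental (Algebra.adjoin R (Set.range x)) a := by
    intro halg
    obtain ⟨⟨b, hb⟩, hb0, hab⟩ :=
      halg.exists_nonzero_dvd (mem_nonZeroDivisors_of_ne_zero ha)
    rw [Algebra.adjoin_range_eq_range_aeval] at hb
    obtain ⟨p, rfl⟩ := hb
    have hfp : f (MvPolynomial.aeval x p) = 0 :=
      zero_dvd_iff.mp (hfa ▸ map_dvd f hab)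
    have hp : p = 0 := hs.1.eq_zero_of_aeval_eq_zero p <| by
      rw [← hfx, ← hfp]
      exact (MvPolynomial.comp_aeval_apply x f p).symm
    exact hb0 (Subtype.ext (by simp [hp]))
  have hcard := ((hx.option_iff_transcendental a).mpr htrans).cardinalMk_le_trdeg
  rwa [Cardinal.mk_option, hs.cardinalMk_eq_trdeg] at hcard

/-- The transcendence degree of the residue domain strictly drops along strict inclusions of
prime ideals. -/
theorem Algebra.trdeg_quotient_add_one_le_of_lt {R A : Type*} [Field R] [CommRing A]
    [Algebra R A] {p q : Ideal A} [p.IsPrime] [q.IsPrime] (hpq : p < q) :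
    Algebra.trdeg R (A ⧸ q) + 1 ≤ Algebra.trdeg R (A ⧸ p) := by
  obtain ⟨a, haq, hap⟩ := SetLike.exists_of_lt hpq
  exact Algebra.trdeg_add_one_le_of_surjective_of_map_eq_zero
    (Ideal.Quotient.factorₐ R hpq.le) (Ideal.Quotient.factor_surjective hpq.le)
    (a := Ideal.Quotient.mk p a) (by rwa [Ne, Ideal.Quotient.eq_zero_iff_mem])
    (by simpa [Ideal.Quotient.eq_zero_iff_mem] using haq)

/-- The transcendence degree `trdeg` is Mathlib's `Algebra.trdeg`. -/
theorem trdeg_eq_algebraTrdeg (k A : Type) [CommRing k] [CommRing A] [Algebra k A] :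
    trdeg k A = Algebra.trdeg k A := rfl

/-- **Lemma 8.**
Let `G` be an integral domain containing a field `k` and let `P` be a prime ideal of `G`.
Assume that both `trdeg_k G` and `trdeg_k G/P` are finite.  Then the height of `P`
(computed in `PrimeSpectrum G`) is at most `trdeg_k G - trdeg_k G/P`. -/
theorem height_le_trdeg_sub_trdeg_quotient (k G : Type) [Field k] [CommRing G]
    [IsDomain G] [Algebra k G] (P : Ideal G) (hP : P.IsPrime)
    (hG : trdeg k G < Cardinal.aleph0) (hGP : trdeg k (G ⧸ P) < Cardinal.aleph0) :
    Order.height (⟨P, hP⟩ : PrimeSpectrum G)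
      ≤ (((trdeg k G).toNat - (trdeg k (G ⧸ P)).toNat : ℕ) : ℕ∞) := by
  simp only [trdeg_eq_algebraTrdeg] at *
  have hle (p : PrimeSpectrum G) : Algebra.trdeg k (G ⧸ p.asIdeal) ≤ Algebra.trdeg k G :=
    trdeg_le_of_surjective (Ideal.Quotient.mkₐ k p.asIdeal)
      (Ideal.Quotient.mkₐ_surjective k p.asIdeal)
  have hmono : StrictMono fun p : PrimeSpectrum G ↦
      (Algebra.trdeg k G).toNat - (Algebra.trdeg k (G ⧸ p.asIdeal)).toNat := by
    intro p q hpq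
    have hlt : (Algebra.trdeg k (G ⧸ q.asIdeal)).toNat + 1 ≤
        (Algebra.trdeg k (G ⧸ p.asIdeal)).toNat := by
      have h := Cardinal.toNat_le_toNat (Algebra.trdeg_quotient_add_one_le_of_lt (R := k)
        (show p.asIdeal < q.asIdeal from hpq)) ((hle p).trans_lt hG)
      rwa [Cardinal.toNat_add ((hle q).trans_lt hG) Cardinal.one_lt_aleph0,
        Cardinal.one_toNat] at h
    have := Cardinal.toNat_le_toNat (hle p) hG
    dsimp only
    omega
  simpa using Order.height_le_height_apply_of_strictMono _ hmono ⟨P, hP⟩
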